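/- Let s ∈ (1/2, 1), v ∈ H^{k+s}_loc(ℝ) with v^{(k)} bounded and having values in the class of admissible profiles, and let u_ε(t) = v((t − t₀)/ε) glued at a single jump point t₀ ∈ (0,1) into a piecewise constant function u = −1 + 2·1_{(t₀,1)} (i.e., u_ε agrees with u outside (t₀ − εT, t₀ + εT) where v(x) = ±1 for |x| ≥ T). Then ε^{2(k+s)−1}[u_ε]²_{k+s}(0,1) → [v]²_{k+s}(ℝ) and (1/ε)∫₀¹ W(u_ε) dt = ∫_{−T}^{T} W(v) dt for ε small, so F_ε(u_ε) → ∫_ℝ W(v) + [v]²_{k+s}(ℝ). -/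

import Mathlib

open MeasureTheory Set Filter

/-- Squared Gagliardo seminorm of order `k+s` of `u` on `(0,1)`. -/
noncomputable def gagliardoSq (k : ℕ) (s : ℝ) (u : ℝ → ℝ) : ℝ :=
  ∫ x in Set.Ioo (0:ℝ) 1, ∫ y in Set.Ioo (0:ℝ) 1,
    (iteratedDeriv k u x - iteratedDeriv k u y) ^ 2 / |x - y| ^ (1 + 2 * s)

/-- Squared Gagliardo seminorm of order `k+s` of `v` on the whole real line. -/
noncomputable def gagliardoSqR (k : ℕ) (s : ℝ) (v : ℝ → ℝ) : ℝ :=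
  ∫ x : ℝ, ∫ y : ℝ,
    (iteratedDeriv k v x - iteratedDeriv k v y) ^ 2 / |x - y| ^ (1 + 2 * s)

/-- Tail of a power kernel. -/
noncomputable def tailF (α p : ℝ) (z : ℝ) : ℝ := (Set.Ici p).indicator (fun t => t ^ (-α)) |z|

/-- The kernel. -/
noncomputable def kerK (g : ℝ → ℝ) (α : ℝ) (x y : ℝ) : ℝ := (g x - g y) ^ 2 / |x - y| ^ α

lemma tailF_nonneg (α p z : ℝ) : 0 ≤ tailF α p z := by
  unfold tailF
  by_cases h : |z| ∈ Set.Ici p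
  · rw [Set.indicator_of_mem h]; positivity
  · rw [Set.indicator_of_notMem h]

lemma kerK_nonneg (g : ℝ → ℝ) (α x y : ℝ) : 0 ≤ kerK g α x y := by
  unfold kerK; positivity

lemma tailF_integral {α p : ℝ} (hα : 1 < α) (hp : 0 < p) :
    ∫ z, tailF α p z = 2 / (α - 1) * p ^ (-(α - 1)) := by
  unfold tailF
  rw [integral_comp_abs (f := (Set.Ici p).indicator (fun t => t ^ (-α))),
    setIntegral_indicator measurableSet_Ici,
    show Set.Ioi (0:ℝ) ∩ Set.Ici p = Set.Ici p from
      Set.inter_eq_right.2 (fun x hx => lt_of_lt_of_le hp hx),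
    integral_Ici_eq_integral_Ioi, integral_Ioi_rpow_of_lt (by linarith) hp]
  rw [show -(α - 1) = -α + 1 by ring]
  have h1 : -α + 1 ≠ 0 := by linarith
  have h2 : α - 1 ≠ 0 := by linarith
  have h3 : α - 1 = -(-α + 1) := by ring
  rw [h3, div_neg, neg_div]; ring

lemma tailF_integrable {α p : ℝ} (hα : 1 < α) (hp : 0 < p) : Integrable (tailF α p) := by
  apply Integrable.of_integral_ne_zero
  rw [tailF_integral hα hp]
  have : 0 < α - 1 := by linarith
  positivity

lemma kerK_le {g : ℝ → ℝ} {C α p x y : ℝ} (hC : ∀ x y, (g x - g y) ^ 2 ≤ C)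
    (h : p ≤ |x - y| ∨ g x = g y) : kerK g α x y ≤ C * tailF α p (y - x) := by
  have hC0 : 0 ≤ C := (sq_nonneg _).trans (hC 0 0)
  rcases h with h | h
  · unfold kerK tailF
    rw [abs_sub_comm x y] at *
    rw [Set.indicator_of_mem (show |y - x| ∈ Set.Ici p from h), Real.rpow_neg (abs_nonneg _),
      div_eq_mul_inv]
    exact mul_le_mul_of_nonneg_right (hC x y) (by positivity)
  · have : kerK g α x y = 0 := by simp [kerK, h]
    rw [this]
    exact mul_nonneg hC0 (tailF_nonneg _ _ _)

lemma kerK_meas {g : ℝ → ℝ} (hg : Continuous g) (α : ℝ) :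
    StronglyMeasurable (Function.uncurry (kerK g α)) := by
  have := hg.measurable
  apply Measurable.stronglyMeasurable
  unfold kerK Function.uncurry
  fun_prop

lemma kerK_meas_right {g : ℝ → ℝ} (hg : Continuous g) (α x : ℝ) :
    Measurable (kerK g α x) := by
  have := hg.measurable
  unfold kerK
  fun_prop

section
variable {g : ℝ → ℝ} {C α T cp cm : ℝ}

/-- far field bound: for `x` inside, `y` outside -/
lemma kerK_far (hC : ∀ x y, (g x - g y) ^ 2 ≤ C) (hp : ∀ x, T < x → g x = cp)
    (hm : ∀ x, x < -T → g x = cm) {A B x y : ℝ} (hA : T + 1 ≤ A) (hB : T + 1 ≤ B)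
    (hx : x ∈ Set.Ioo (-A) B) (hy : y ∉ Set.Ioo (-A) B) (hT : 0 < T) :
    kerK g α x y ≤ C * tailF α 1 (y - x) := by
  apply kerK_le hC
  by_cases h : y ≤ -A
  · by_cases h2 : x < -T
    · right; rw [hm x h2, hm y (by linarith)]
    · left; rw [le_abs]; left; linarith
  · have h3 : B ≤ y := by
      by_contra h4
      exact hy ⟨by linarith, by linarith⟩
    by_cases h2 : T < x
    · right; rw [hp x h2, hp y (by linarith)]
    · left; rw [le_abs]; right; linarith

lemma kerK_out (hC : ∀ x y, (g x - g y) ^ 2 ≤ C) (hp : ∀ x, T < x → g x = cp)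
    (hm : ∀ x, x < -T → g x = cm) {x y : ℝ} (hx : T + 1 ≤ |x|) :
    kerK g α x y ≤ C * tailF α (|x| - T) (y - x) := by
  apply kerK_le hC
  rcases le_total 0 x with h0 | h0
  · rw [abs_of_nonneg h0] at *
    by_cases h2 : T < y
    · right; rw [hp x (by linarith), hp y h2]
    · left
      rw [le_abs]; left; linarith
  · rw [abs_of_nonpos h0] at *
    by_cases h2 : y < -T
    · right; rw [hm x (by linarith), hm y h2]
    · left
      rw [le_abs]; right; linarith

lemma outer_integrable (hg : Continuous g) (hC : ∀ x y, (g x - g y) ^ 2 ≤ C)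
    (hp : ∀ x, T < x → g x = cp)
    (hm : ∀ x, x < -T → g x = cm) (hT : 0 < T) (hα : 2 < α) {S : Set ℝ} (hSm : MeasurableSet S)
    (hS : ∀ x ∈ S, T + 1 ≤ |x|) :
    IntegrableOn (fun x => ∫ y, kerK g α x y) S := by
  have hC0 : 0 ≤ C := (sq_nonneg _).trans (hC 0 0)
  have hα1 : 0 < α - 1 := by linarith
  have hb : Integrable (fun x => C * (2 / (α - 1) * ((T + 1) ^ (α - 1) * tailF (α - 1) (T + 1) x))) :=
    (((tailF_integrable (by linarith) (by linarith)).const_mul _).const_mul _).const_mul _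
  refine Integrable.mono' (hb.integrableOn (s := S))
    (kerK_meas hg α).integral_prod_right.aestronglyMeasurable ?_
  filter_upwards [ae_restrict_mem hSm] with x hx
  have hx := hS x hx
  rw [Real.norm_of_nonneg (integral_nonneg (fun y => kerK_nonneg _ _ _ _))]
  have hpos : 0 < |x| - T := by linarith
  calc ∫ y, kerK g α x y ≤ ∫ y, C * tailF α (|x| - T) (y - x) := by
        apply integral_mono_of_nonneg (ae_of_all _ (fun y => kerK_nonneg _ _ _ _))
        · exact ((tailF_integrable (by linarith) hpos).comp_sub_right x).const_mul C
        · exact ae_of_all _ (fun y => kerK_out hC hp hm hx)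
    _ = C * (2 / (α - 1) * (|x| - T) ^ (-(α - 1))) := by
        rw [integral_const_mul, integral_sub_right_eq_self (tailF α (|x| - T)) x,
          tailF_integral (by linarith) hpos]
    _ ≤ _ := by
        have : (|x| - T) ^ (-(α - 1)) ≤ (T + 1) ^ (α - 1) * tailF (α - 1) (T + 1) x := by
          unfold tailF
          rw [Set.indicator_of_mem (show |x| ∈ Set.Ici (T+1) from hx)]
          have h1 : |x| / (T + 1) ≤ |x| - T := by
            rw [div_le_iff₀ (by linarith)]; nlinarith
          have h0 : 0 < |x| := by linarith
          calc (|x| - T) ^ (-(α - 1)) ≤ (|x| / (T + 1)) ^ (-(α - 1)) :=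
                Real.rpow_le_rpow_of_nonpos (by positivity) h1 (by linarith)
            _ = _ := by
                rw [Real.div_rpow h0.le (by linarith), Real.rpow_neg (by linarith : 0 ≤ T + 1)]
                field_simp
        gcongr

/-- integrability on J equals integrability on the line -/
lemma inner_integrable (hg : Continuous g) (hC : ∀ x y, (g x - g y) ^ 2 ≤ C)
    (hp : ∀ x, T < x → g x = cp)
    (hm : ∀ x, x < -T → g x = cm) (hT : 0 < T) (hα : 2 < α) {A B x : ℝ}
    (hA : T + 1 ≤ A) (hB : T + 1 ≤ B) (hx : x ∈ Set.Ioo (-A) B) :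
    IntegrableOn (kerK g α x) (Set.Ioo (-A) B)ᶜ ∧
      ∫ y in (Set.Ioo (-A) B)ᶜ, kerK g α x y ≤ C * ∫ z, tailF α 1 z := by
  have hC0 : 0 ≤ C := (sq_nonneg _).trans (hC 0 0)
  have hb : Integrable (fun y => C * tailF α 1 (y - x)) :=
    ((tailF_integrable (by linarith) one_pos).comp_sub_right x).const_mul C
  have hle : ∀ᵐ y ∂(volume.restrict (Set.Ioo (-A) B)ᶜ), kerK g α x y ≤ C * tailF α 1 (y - x) := by
    filter_upwards [ae_restrict_mem measurableSet_Ioo.compl] with y hy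
    exact kerK_far hC hp hm hA hB hx hy hT
  constructor
  · refine Integrable.mono' hb.integrableOn (kerK_meas_right hg α x).aestronglyMeasurable ?_
    filter_upwards [hle] with y hy
    rwa [Real.norm_of_nonneg (kerK_nonneg _ _ _ _)]
  · calc _ ≤ ∫ y in (Set.Ioo (-A) B)ᶜ, C * tailF α 1 (y - x) :=
          integral_mono_of_nonneg (ae_of_all _ (fun y => kerK_nonneg _ _ _ _)) hb.integrableOn hle
      _ ≤ ∫ y, C * tailF α 1 (y - x) :=
          setIntegral_le_integral hb
            (ae_of_all _ (fun y => mul_nonneg hC0 (tailF_nonneg _ _ _)))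
      _ = _ := by
        rw [integral_const_mul, integral_sub_right_eq_self (tailF α 1) x]

lemma integrable_of_J (hg : Continuous g) (hC : ∀ x y, (g x - g y) ^ 2 ≤ C)
    (hp : ∀ x, T < x → g x = cp)
    (hm : ∀ x, x < -T → g x = cm) (hT : 0 < T) (hα : 2 < α) {A B : ℝ}
    (hA : T + 1 ≤ A) (hB : T + 1 ≤ B)
    (h : IntegrableOn (fun x => ∫ y in Set.Ioo (-A) B, kerK g α x y) (Set.Ioo (-A) B)) :
    Integrable (fun x => ∫ y, kerK g α x y) := by
  rw [← integrableOn_univ, ← Set.union_compl_self (Set.Ioo (-A) B)]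
  apply IntegrableOn.union
  · have hb : IntegrableOn (fun x => (∫ y in Set.Ioo (-A) B, kerK g α x y) + C * ∫ z, tailF α 1 z)
      (Set.Ioo (-A) B) := Integrable.add h (integrable_const _)
    refine Integrable.mono' hb (kerK_meas hg α).integral_prod_right.aestronglyMeasurable ?_
    filter_upwards [ae_restrict_mem measurableSet_Ioo] with x hx
    rw [Real.norm_of_nonneg (integral_nonneg (fun y => kerK_nonneg _ _ _ _))]
    obtain ⟨h1, h2⟩ := inner_integrable (α := α) hg hC hp hm hT hα hA hB hx
    by_cases hi : Integrable (kerK g α x)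
    · rw [← integral_add_compl measurableSet_Ioo hi]
      gcongr
    · rw [integral_undef hi]
      have := h2.trans' (integral_nonneg (fun y => kerK_nonneg _ _ _ _))
      have h3 : 0 ≤ ∫ y in Set.Ioo (-A) B, kerK g α x y :=
        integral_nonneg (fun y => kerK_nonneg _ _ _ _)
      linarith
  · apply outer_integrable hg hC hp hm hT hα measurableSet_Ioo.compl
    intro x hx
    rw [le_abs]
    by_contra! h
    exact hx ⟨by linarith, by linarith⟩

lemma core_tendsto (hg : Continuous g) (hC : ∀ x y, (g x - g y) ^ 2 ≤ C)
    (hp : ∀ x, T < x → g x = cp)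
    (hm : ∀ x, x < -T → g x = cm) (hT : 0 < T) (hα : 2 < α) {ι : Type*} {l : Filter ι}
    [l.IsCountablyGenerated] {A B : ι → ℝ} (hA : Tendsto A l atTop) (hB : Tendsto B l atTop) :
    Tendsto (fun i => ∫ x in Set.Ioo (-(A i)) (B i), ∫ y in Set.Ioo (-(A i)) (B i), kerK g α x y) l
      (nhds (∫ x, ∫ y, kerK g α x y)) := by
  have hmem : ∀ x : ℝ, ∀ᶠ i in l, x ∈ Set.Ioo (-(A i)) (B i) := by
    intro x
    filter_upwards [hA.eventually_gt_atTop (-x), hB.eventually_gt_atTop x] with i h1 h2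
    exact ⟨by linarith, h2⟩
  by_cases hi : Integrable (fun x => ∫ y, kerK g α x y)
  · simp_rw [← integral_indicator (measurableSet_Ioo (α := ℝ))]
    rw [show (∫ x, ∫ y, kerK g α x y) = ∫ x, ∫ y, kerK g α x y from rfl]
    refine tendsto_integral_filter_of_dominated_convergence (fun x => ∫ y, kerK g α x y) ?_ ?_ hi ?_
    · refine Eventually.of_forall fun i => ?_
      have : StronglyMeasurable (fun x => ∫ y in Set.Ioo (-(A i)) (B i), kerK g α x y) :=
        (kerK_meas hg α).integral_prod_right
      simp_rw [← integral_indicator (measurableSet_Ioo (α := ℝ))] at this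
      exact (this.indicator measurableSet_Ioo).aestronglyMeasurable
    · filter_upwards [hA.eventually_ge_atTop (T+1), hB.eventually_ge_atTop (T+1)] with i h1 h2
      refine ae_of_all _ fun x => ?_
      by_cases hx : x ∈ Set.Ioo (-(A i)) (B i)
      · rw [Set.indicator_of_mem hx, integral_indicator measurableSet_Ioo,
          Real.norm_of_nonneg (integral_nonneg (fun y => kerK_nonneg _ _ _ _))]
        by_cases hk : Integrable (kerK g α x)
        · exact setIntegral_le_integral hk (ae_of_all _ (fun y => kerK_nonneg _ _ _ _))
        · rw [integral_undef hk, integral_undef]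
          intro hk2
          apply hk
          rw [← integrableOn_univ, ← Set.union_compl_self (Set.Ioo (-(A i)) (B i))]
          exact IntegrableOn.union hk2 (inner_integrable hg hC hp hm hT hα h1 h2 hx).1
      · rw [Set.indicator_of_notMem hx, norm_zero]
        exact integral_nonneg (fun y => kerK_nonneg _ _ _ _)
    · refine ae_of_all _ fun x => ?_
      by_cases hk : Integrable (kerK g α x)
      · have : Tendsto (fun i => ∫ y, (Set.Ioo (-(A i)) (B i)).indicator (kerK g α x) y) l
            (nhds (∫ y, kerK g α x y)) := by
          refine tendsto_integral_filter_of_dominated_convergence (fun y => kerK g α x y) ?_ ?_ hk ?_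
          · exact Eventually.of_forall fun i =>
              (hk.aestronglyMeasurable.indicator measurableSet_Ioo)
          · refine Eventually.of_forall fun i => ae_of_all _ fun y => ?_
            refine (norm_indicator_le_norm_self _ _).trans ?_
            rw [Real.norm_of_nonneg (kerK_nonneg _ _ _ _)]
          · refine ae_of_all _ fun y => tendsto_const_nhds.congr' ?_
            filter_upwards [hmem y] with i h
            rw [Set.indicator_of_mem h]
        refine this.congr' ?_
        filter_upwards [hmem x] with i h
        rw [Set.indicator_of_mem h]
      · rw [integral_undef hk]
        refine tendsto_const_nhds.congr' ?_
        filter_upwards [hmem x, hA.eventually_ge_atTop (T+1), hB.eventually_ge_atTop (T+1)]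
          with i hx h1 h2
        rw [Set.indicator_of_mem hx, integral_indicator measurableSet_Ioo, integral_undef]
        intro hk2
        apply hk
        rw [← integrableOn_univ, ← Set.union_compl_self (Set.Ioo (-(A i)) (B i))]
        exact IntegrableOn.union hk2 (inner_integrable hg hC hp hm hT hα h1 h2 hx).1
  · rw [integral_undef hi]
    refine tendsto_const_nhds.congr' ?_
    filter_upwards [hA.eventually_ge_atTop (T+1), hB.eventually_ge_atTop (T+1)] with i h1 h2
    rw [integral_undef]
    intro h
    exact hi (integrable_of_J hg hC hp hm hT hα h1 h2 h)
end

lemma change_var (G : ℝ → ℝ) {ε t₀ : ℝ} (hε : 0 < ε) :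
    ∫ x in Set.Ioo (0:ℝ) 1, G ((x - t₀) / ε) =
      ε * ∫ x in Set.Ioo (-(t₀ / ε)) ((1 - t₀) / ε), G x := by
  rw [← integral_indicator measurableSet_Ioo, ← integral_indicator measurableSet_Ioo]
  have h1 : ∀ x, (Set.Ioo (0:ℝ) 1).indicator (fun x => G ((x - t₀) / ε)) x =
      (Set.Ioo (-(t₀ / ε)) ((1 - t₀) / ε)).indicator G ((x - t₀) / ε) := by
    intro x
    have : x ∈ Set.Ioo (0:ℝ) 1 ↔ (x - t₀) / ε ∈ Set.Ioo (-(t₀ / ε)) ((1 - t₀) / ε) := by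
      simp only [Set.mem_Ioo, ← neg_div]
      rw [div_lt_div_iff_of_pos_right hε, div_lt_div_iff_of_pos_right hε]
      constructor <;> rintro ⟨h1, h2⟩ <;> constructor <;> linarith
    simp only [Set.indicator_apply, this]
  simp_rw [h1]
  rw [integral_sub_right_eq_self (fun x => (Set.Ioo (-(t₀ / ε)) ((1 - t₀) / ε)).indicator G (x / ε)),
    Measure.integral_comp_div (fun x => (Set.Ioo (-(t₀ / ε)) ((1 - t₀) / ε)).indicator G x) ε, abs_of_pos hε, smul_eq_mul]

lemma glue_eq {T : ℝ} {v : ℝ → ℝ} 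
    (hvplus : ∀ x ≥ T, v x = 1) (hvminus : ∀ x ≤ -T, v x = -1) (hT : 0 < T) {ε t₀ : ℝ} (hε : 0 < ε) :
    (fun t => if |t - t₀| ≤ ε * T then v ((t - t₀) / ε)
              else (if t < t₀ then -1 else 1)) = fun t => v ((t - t₀) / ε) := by
  funext t
  split_ifs with h1 h2
  · rfl
  · rw [hvminus]
    rw [div_le_iff₀ hε]
    rw [abs_of_neg (by linarith)] at h1
    linarith
  · rw [hvplus]
    rw [ge_iff_le, le_div_iff₀ hε]
    rw [abs_of_nonneg (by linarith)] at h1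
    linarith

lemma scaling (k : ℕ) (s : ℝ) {v : ℝ → ℝ} (hv : ContDiff ℝ k v) {ε t₀ : ℝ} (hε : 0 < ε) :
    ε ^ (2 * ((k : ℝ) + s) - 1) * gagliardoSq k s (fun t => v ((t - t₀) / ε)) =
     ∫ x in Set.Ioo (-(t₀ / ε)) ((1 - t₀) / ε), ∫ y in Set.Ioo (-(t₀ / ε)) ((1 - t₀) / ε),
      kerK (iteratedDeriv k v) (1 + 2 * s) x y := by
  set g := iteratedDeriv k v with hg
  have hd : ∀ x, iteratedDeriv k (fun t => v ((t - t₀) / ε)) x = (ε⁻¹) ^ k * g ((x - t₀) / ε) := by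
    intro x
    have h1 := congrFun (iteratedDeriv_comp_sub_const k (fun t => v (ε⁻¹ * t)) t₀) x
    rw [iteratedDeriv_comp_const_mul hv] at h1
    simp only [div_eq_inv_mul]
    exact h1
  have hk : ∀ x y, ((ε⁻¹) ^ k * g ((x - t₀) / ε) - (ε⁻¹) ^ k * g ((y - t₀) / ε)) ^ 2
      / |x - y| ^ (1 + 2 * s) = (ε ^ (2 * ((k : ℝ) + s) + 1))⁻¹ *
        kerK g (1 + 2 * s) ((x - t₀) / ε) ((y - t₀) / ε) := by
    intro x y
    unfold kerK
    rw [← sub_div, abs_div, abs_of_pos hε, sub_sub_sub_cancel_right,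
      Real.div_rpow (abs_nonneg _) hε.le, ← mul_sub, mul_pow,
      show 2 * ((k : ℝ) + s) + 1 = ((k * 2 : ℕ) : ℝ) + (1 + 2 * s) by push_cast; ring,
      Real.rpow_add hε, Real.rpow_natCast]
    have : 0 < ε ^ (1 + 2 * s) := by positivity
    rw [inv_pow, inv_pow, ← pow_mul]
    by_cases h0 : |x - y| ^ (1 + 2 * s) = 0
    · rw [h0]; simp
    · field_simp
  unfold gagliardoSq
  simp only [hd, hk]
  simp only [integral_const_mul]
  simp only [change_var (kerK g (1 + 2 * s) _) hε]
  rw [change_var (fun z => ε * ∫ y in Set.Ioo (-(t₀ / ε)) ((1 - t₀) / ε), kerK g (1 + 2 * s) z y) hε,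
    integral_const_mul]
  have : ε ^ (2 * ((k : ℝ) + s) + 1) = ε ^ (2 * ((k : ℝ) + s) - 1) * (ε * ε) := by
    rw [show 2 * ((k : ℝ) + s) + 1 = (2 * ((k : ℝ) + s) - 1) + (2:ℕ) by push_cast; ring,
      Real.rpow_add hε, Real.rpow_natCast]; ring
  rw [this]
  have : 0 < ε ^ (2 * ((k : ℝ) + s) - 1) := by positivity
  field_simp

lemma deriv_far (k : ℕ) {T : ℝ} {v : ℝ → ℝ} 
    (hvplus : ∀ x ≥ T, v x = 1) (hvminus : ∀ x ≤ -T, v x = -1) :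
    (∀ x, T < x → iteratedDeriv k v x = if k = 0 then 1 else 0) ∧
    (∀ x, x < -T → iteratedDeriv k v x = if k = 0 then -1 else 0) := by
  constructor
  · intro x hx
    have : v =ᶠ[nhds x] fun _ => 1 := by
      filter_upwards [Ioi_mem_nhds hx] with y hy using hvplus y (le_of_lt hy)
    rw [this.iteratedDeriv_eq k, iteratedDeriv_const]
  · intro x hx
    have : v =ᶠ[nhds x] fun _ => -1 := by
      filter_upwards [Iio_mem_nhds hx] with y hy using hvminus y (le_of_lt hy)
    rw [this.iteratedDeriv_eq k, iteratedDeriv_const]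

lemma bdd_osc {g : ℝ → ℝ} {T cp cm : ℝ} (hg : Continuous g) (hp : ∀ x, T < x → g x = cp)
    (hm : ∀ x, x < -T → g x = cm) : ∃ C, ∀ x y, (g x - g y) ^ 2 ≤ C := by
  obtain ⟨M, hM⟩ := (isCompact_Icc (a := -T) (b := T)).exists_bound_of_continuousOn hg.continuousOn
  have hb : ∀ x, |g x| ≤ max M (max |cp| |cm|) := by
    intro x
    by_cases h1 : T < x
    · rw [hp x h1]; simp
    by_cases h2 : x < -T
    · rw [hm x h2]; simp
    exact (hM x ⟨by linarith, by linarith⟩).trans (le_max_left _ _)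
  refine ⟨(2 * max M (max |cp| |cm|)) ^ 2, fun x y => sq_le_sq.2 ?_⟩
  refine (abs_sub _ _).trans (le_trans ?_ (le_abs_self _))
  linarith [hb x, hb y]

lemma W_support {W v : ℝ → ℝ} {T : ℝ} (hW1 : W 1 = 0) (hWm1 : W (-1) = 0)
    (hvplus : ∀ x ≥ T, v x = 1) (hvminus : ∀ x ≤ -T, v x = -1) {x : ℝ}
    (hx : x ∉ Set.Ioo (-T) T) : W (v x) = 0 := by
  by_cases h : x ≤ -T
  · rw [hvminus x h, hWm1]
  · rw [hvplus x, hW1]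
    by_contra h2
    exact hx ⟨by linarith, by linarith⟩

/-- energy of the recovery sequence obtained by gluing the scaled
optimal profile at a single jump point `t₀` converges to the optimal-profile energy. -/
theorem recovery_sequence_energy (k : ℕ) (s : ℝ) (hs : s ∈ Set.Ioo (1/2 : ℝ) 1)
    (hks : 1 / 2 < (k : ℝ) + s)
    (W : ℝ → ℝ) (hWcont : Continuous W) (hWnonneg : ∀ z, 0 ≤ W z)
    (hW1 : W 1 = 0) (hWm1 : W (-1) = 0)
    (T : ℝ) (hT : 0 < T) (v : ℝ → ℝ) (hv : ContDiff ℝ k v)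
    (hvplus : ∀ x ≥ T, v x = 1) (hvminus : ∀ x ≤ -T, v x = -1)
    (t₀ : ℝ) (ht₀ : t₀ ∈ Set.Ioo (0:ℝ) 1) :
    (Tendsto
        (fun ε : ℝ => ε ^ (2 * ((k : ℝ) + s) - 1) *
          gagliardoSq k s
            (fun t => if |t - t₀| ≤ ε * T then v ((t - t₀) / ε)
              else (if t < t₀ then -1 else 1)))
        (nhdsWithin 0 (Set.Ioi 0)) (nhds (gagliardoSqR k s v))) ∧
    (∀ᶠ ε : ℝ in nhdsWithin 0 (Set.Ioi 0),
      (1 / ε) * (∫ t in Set.Ioo (0:ℝ) 1,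
          W ((fun t => if |t - t₀| ≤ ε * T then v ((t - t₀) / ε)
              else (if t < t₀ then -1 else 1)) t)) =
        ∫ t in Set.Ioo (-T) T, W (v t)) ∧
    (Tendsto
        (fun ε : ℝ =>
          (1 / ε) * (∫ t in Set.Ioo (0:ℝ) 1,
            W ((fun t => if |t - t₀| ≤ ε * T then v ((t - t₀) / ε)
                else (if t < t₀ then -1 else 1)) t)) +
          ε ^ (2 * ((k : ℝ) + s) - 1) *
            gagliardoSq k s
              (fun t => if |t - t₀| ≤ ε * T then v ((t - t₀) / ε)
                else (if t < t₀ then -1 else 1)))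
        (nhdsWithin 0 (Set.Ioi 0))
        (nhds ((∫ t : ℝ, W (v t)) + gagliardoSqR k s v))) := by
  have hTA : Tendsto (fun ε : ℝ => t₀ / ε) (nhdsWithin 0 (Set.Ioi 0)) atTop :=
    tendsto_inv_nhdsGT_zero.const_mul_atTop ht₀.1
  have hTB : Tendsto (fun ε : ℝ => (1 - t₀) / ε) (nhdsWithin 0 (Set.Ioi 0)) atTop :=
    tendsto_inv_nhdsGT_zero.const_mul_atTop (by linarith [ht₀.2])
  have hpos : ∀ᶠ ε : ℝ in nhdsWithin 0 (Set.Ioi 0), 0 < ε := self_mem_nhdsWithin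
  have P1 : Tendsto
        (fun ε : ℝ => ε ^ (2 * ((k : ℝ) + s) - 1) *
          gagliardoSq k s
            (fun t => if |t - t₀| ≤ ε * T then v ((t - t₀) / ε)
              else (if t < t₀ then -1 else 1)))
        (nhdsWithin 0 (Set.Ioi 0)) (nhds (gagliardoSqR k s v)) := by
    obtain ⟨hp, hm⟩ := deriv_far k hvplus hvminus
    have hg : Continuous (iteratedDeriv k v) := hv.continuous_iteratedDeriv k le_rfl
    obtain ⟨C, hC⟩ := bdd_osc hg hp hm
    refine (core_tendsto (α := 1 + 2 * s) hg hC hp hm hT (by linarith [hs.1]) hTA hTB).congr' ?_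
    filter_upwards [hpos] with ε hε
    rw [glue_eq hvplus hvminus hT hε, scaling k s hv hε]
  have P2 : ∀ᶠ ε : ℝ in nhdsWithin 0 (Set.Ioi 0),
      (1 / ε) * (∫ t in Set.Ioo (0:ℝ) 1,
          W ((fun t => if |t - t₀| ≤ ε * T then v ((t - t₀) / ε)
              else (if t < t₀ then -1 else 1)) t)) =
        ∫ t in Set.Ioo (-T) T, W (v t) := by
    filter_upwards [hpos, hTA.eventually_ge_atTop T, hTB.eventually_ge_atTop T] with ε hε h1 h2
    have hglue := fun t => congrFun (glue_eq (t₀ := t₀) hvplus hvminus hT hε) t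
    simp only [hglue]
    rw [change_var (fun z => W (v z)) hε, ← mul_assoc, one_div, inv_mul_cancel₀ hε.ne', one_mul]
    refine setIntegral_eq_of_subset_of_forall_sdiff_eq_zero measurableSet_Ioo
      (Set.Ioo_subset_Ioo (by linarith) h2) ?_
    intro x hx
    exact W_support hW1 hWm1 hvplus hvminus hx.2
  refine ⟨P1, P2, ?_⟩
  refine Tendsto.add (tendsto_const_nhds.congr' ?_) P1
  filter_upwards [P2] with ε h
  rw [h]
  symm
  exact setIntegral_eq_integral_of_forall_compl_eq_zero
    (fun x hx => W_support hW1 hWm1 hvplus hvminus hx)
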